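/- arXiv:2207.07447 — 3 statements merged into one kernel-verified Lean document; each statement's English description precedes it below -/
import Mathlib

section
/- Let Σ(λ) := {μ ∈ P : μ ⪯ λ} be the lower set of λ in the Cherednik order. Then for every weight λ ∈ P one has Σ(λ) = Conv(Σ(λ)) ∩ (λ + Q), where Conv denotes the convex hull taken in the real vector space ℝ ⊗_ℤ P. -/
/-!
Statement 0 (Lemma on the Cherednik order, [CK18] §2.2.1).

Setup: `E` is the real span of the weight lattice of a finite-dimensional simple
complex Lie algebra, `Δ` its set of positive roots, `α : ι → E` the simple roots,
`pairing β` the linear functional `⟨β∨, ·⟩` given by pairing with the coroot of `β`,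
`W` the Weyl group (generated by the reflections in the roots), `P` the weight
lattice, `Q` the root lattice, `Qplus` the positive monoid `Σᵢ ℕ αᵢ`, and
`dmin : λ ↦ λ₋` the map sending a weight to the unique antidominant element of its
Weyl group orbit.  The Cherednik order `cherLE` is: `λ ⪯ μ` iff `λ₋ ∈ μ₋ + Q₊`, or
`λ₋ = μ₋` and `λ ∈ μ + Q₊`.

Claim: for every `λ ∈ P`, the lower set `Σ(λ) = {μ ∈ P : μ ⪯ λ}` satisfies
`Σ(λ) = Conv(Σ(λ)) ∩ (λ + Q)`, the convex hull being taken in `E = ℝ ⊗_ℤ P`.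
-/
theorem cherednik_lowerSet_eq_convexHull_inter_rootLatticeCoset
    {E : Type} [AddCommGroup E] [Module ℝ E]
    {ι : Type} [Fintype ι] [Nonempty ι]
    (Δ : Finset E) (α : ι → E) (pairing : E → E →ₗ[ℝ] ℝ)
    (W : Subgroup (E ≃ₗ[ℝ] E))
    (dmin : E → E)
    -- axioms of the (simple, crystallographic) root datum
    (hα : ∀ i, α i ∈ Δ)
    (hαindep : LinearIndependent ℝ α)
    (hpos : ∀ β ∈ Δ, β ∈ AddSubmonoid.closure (Set.range α))
    (hpair_self : ∀ β ∈ Δ, pairing β β = 2)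
    (hcrys : ∀ β ∈ Δ, ∀ γ ∈ Δ, ∃ m : ℤ, pairing β γ = (m : ℝ))
    (hW : W = Subgroup.closure
      {g : E ≃ₗ[ℝ] E | ∃ β ∈ Δ, ∀ x : E, g x = x - pairing β x • β})
    (hWfin : Finite W)
    (hWroots : ∀ w ∈ W, ∀ β ∈ Δ, (w β ∈ Δ ∨ -(w β) ∈ Δ))
    -- `dmin λ = λ₋`, the antidominant representative of the orbit `W λ`
    (hdmin_orbit : ∀ x : E, ∃ w ∈ W, dmin x = w x)
    (hdmin_antidom : ∀ x : E, ∀ β ∈ Δ, pairing β (dmin x) ≤ 0)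
    (hdmin_unique : ∀ x : E, ∀ w ∈ W, (∀ β ∈ Δ, pairing β ((w : E ≃ₗ[ℝ] E) x) ≤ 0) →
      (w : E ≃ₗ[ℝ] E) x = dmin x)
    -- the weight lattice `P`, root lattice `Q`, positive monoid `Q₊`
    (P : Set E) (hP : P = {x : E | ∀ β ∈ Δ, ∃ m : ℤ, pairing β x = (m : ℝ)})
    (Q : AddSubgroup E) (hQ : Q = AddSubgroup.closure (Set.range α))
    (Qplus : AddSubmonoid E) (hQplus : Qplus = AddSubmonoid.closure (Set.range α))
    -- the Cherednik order
    (cherLE : E → E → Prop)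
    (hcher : ∀ x y : E, cherLE x y ↔
      (dmin x - dmin y ∈ Qplus ∨ (dmin x = dmin y ∧ x - y ∈ Qplus)))
    (lam : E) (hlam : lam ∈ P) :
    {μ ∈ P | cherLE μ lam} =
      (convexHull ℝ) {μ ∈ P | cherLE μ lam} ∩ {x : E | ∃ q ∈ Q, x = lam + q} := by
  subst hP hQ hQplus
  -- a height functional
  obtain ⟨f, hf⟩ : ∃ f : E →ₗ[ℝ] ℝ, ∀ i, f (α i) = 1 := by
    obtain ⟨f, hf⟩ := LinearMap.exists_extend ((Module.Basis.span hαindep).constr ℝ (fun _ => (1 : ℝ)))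
    refine ⟨f, fun i => ?_⟩
    have h1 := LinearMap.congr_fun hf (Module.Basis.span hαindep i)
    rw [Module.Basis.constr_basis] at h1
    simpa [Module.Basis.span_apply] using h1
  have hfpos : ∀ β ∈ Δ, 0 < f β := by
    intro β hβ
    have h1 : β = 0 ∨ 0 < f β := by
      refine AddSubmonoid.closure_induction (motive := fun x _ => x = 0 ∨ 0 < f x) ?_ ?_ ?_ (hpos β hβ)
      · rintro _ ⟨i, rfl⟩
        right; rw [hf]; exact one_pos
      · left; rfl
      · rintro x y _ _ (rfl | hx) (rfl | hy)
        · left; simp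
        · right; simpa using hy
        · right; simpa using hx
        · right; rw [map_add]; exact add_pos hx hy
    rcases h1 with h1 | h1
    · have := hpair_self β hβ
      rw [h1, map_zero] at this
      norm_num at this
    · exact h1
  -- the real cone
  let K : Submodule NNReal E := Submodule.span NNReal (Set.range α)
  have hQK : ∀ x ∈ AddSubmonoid.closure (Set.range α), x ∈ K := by
    intro x hx
    have : AddSubmonoid.closure (Set.range α) ≤ K.toAddSubmonoid :=
      (AddSubmonoid.closure_le).2 Submodule.subset_span
    exact this hx
  have hKsmul : ∀ (c : ℝ), 0 ≤ c → ∀ x ∈ K, c • x ∈ K := by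
    intro c hc x hx
    exact K.smul_mem ⟨c, hc⟩ hx
  -- reflections
  have hrefl : ∀ β ∈ Δ, ∃ g ∈ W, ∀ x : E, g x = x - pairing β x • β := by
    intro β hβ
    refine ⟨Module.reflection (hpair_self β hβ), ?_, fun x => Module.reflection_apply _ _⟩
    rw [hW]
    exact Subgroup.subset_closure ⟨β, hβ, fun x => Module.reflection_apply _ _⟩
  -- the antidominant element is the lowest one in its orbit
  have hlow : ∀ x : E, x - dmin x ∈ K := by
    intro x
    obtain ⟨w, hw, hmin⟩ := Set.exists_min_image {w : W | x - (w : E ≃ₗ[ℝ] E) x ∈ K}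
      (fun w => f ((w : E ≃ₗ[ℝ] E) x)) (Set.toFinite _) ⟨1, by simp⟩
    rw [← hdmin_unique x w w.2 ?_]
    · exact hw
    intro β hβ
    by_contra! hc
    obtain ⟨g, hg, hgx⟩ := hrefl β hβ
    have h1 : ((⟨g, hg⟩ * w : W) : E ≃ₗ[ℝ] E) x =
        (w : E ≃ₗ[ℝ] E) x - pairing β ((w : E ≃ₗ[ℝ] E) x) • β := hgx _
    have h2 := hmin (⟨g, hg⟩ * w) (by
      show x - ((⟨g, hg⟩ * w : W) : E ≃ₗ[ℝ] E) x ∈ K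
      rw [h1, sub_sub_eq_add_sub, add_sub_right_comm]
      exact K.add_mem hw (hKsmul _ hc.le _ (hQK _ (hpos β hβ))))
    simp only [h1, map_sub, map_smul, smul_eq_mul] at h2
    have := mul_pos hc (hfpos β hβ)
    linarith
  have hdW : ∀ x : E, ∀ w ∈ W, dmin (w x) = dmin x := by
    intro x w hw
    obtain ⟨v, hv, hvx⟩ := hdmin_orbit (w x)
    rw [hvx]
    refine hdmin_unique x (v * w) (W.mul_mem hv hw) ?_
    intro β hβ
    have := hdmin_antidom (w x) β hβ
    rw [hvx] at this
    exact this
  -- roots lie in the root lattice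
  have hΔQ : ∀ β ∈ Δ, β ∈ AddSubgroup.closure (Set.range α) := by
    intro β hβ
    have : AddSubmonoid.closure (Set.range α) ≤
        (AddSubgroup.closure (Set.range α)).toAddSubmonoid :=
      (AddSubmonoid.closure_le).2 AddSubgroup.subset_closure
    exact this (hpos β hβ)
  have hQP : ∀ q ∈ AddSubgroup.closure (Set.range α), ∀ β ∈ Δ, ∃ m : ℤ, pairing β q = (m : ℝ) := by
    intro q hq β hβ
    refine AddSubgroup.closure_induction (p := fun x _ => ∃ m : ℤ, pairing β x = (m : ℝ)) ?_ ?_ ?_ ?_ hq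
    · rintro _ ⟨i, rfl⟩
      exact hcrys β hβ _ (hα i)
    · exact ⟨0, by simp⟩
    · rintro x y _ _ ⟨a, ha⟩ ⟨b, hb⟩
      exact ⟨a + b, by rw [map_add, ha, hb]; push_cast; rfl⟩
    · rintro x _ ⟨a, ha⟩
      exact ⟨-a, by rw [map_neg, ha]; push_cast; rfl⟩
  -- the Weyl group moves weights by the root lattice
  have hWQ : ∀ w ∈ W, ∀ x : E, (∀ β ∈ Δ, ∃ m : ℤ, pairing β x = (m : ℝ)) →
      w x - x ∈ AddSubgroup.closure (Set.range α) := by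
    have hPadd : ∀ x y : E, (∀ β ∈ Δ, ∃ m : ℤ, pairing β x = (m : ℝ)) →
        y - x ∈ AddSubgroup.closure (Set.range α) →
        (∀ β ∈ Δ, ∃ m : ℤ, pairing β y = (m : ℝ)) := by
      intro x y hx hy β hβ
      obtain ⟨a, ha⟩ := hx β hβ
      obtain ⟨b, hb⟩ := hQP _ hy β hβ
      refine ⟨b + a, ?_⟩
      rw [map_sub] at hb
      push_cast
      linarith
    have hgen : ∀ g : E ≃ₗ[ℝ] E, (∃ β ∈ Δ, ∀ x : E, g x = x - pairing β x • β) →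
        ∀ x : E, (∀ β ∈ Δ, ∃ m : ℤ, pairing β x = (m : ℝ)) →
          g x - x ∈ AddSubgroup.closure (Set.range α) := by
      rintro g ⟨β, hβ, hg⟩ x hx
      obtain ⟨m, hm⟩ := hx β hβ
      rw [hg, hm, sub_sub_cancel_left, Int.cast_smul_eq_zsmul]
      exact neg_mem (zsmul_mem (hΔQ β hβ) m)
    have hinv : ∀ g : E ≃ₗ[ℝ] E, (∃ β ∈ Δ, ∀ x : E, g x = x - pairing β x • β) → g⁻¹ = g := by
      rintro g ⟨β, hβ, hg⟩
      rw [inv_eq_iff_mul_eq_one]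
      ext x
      show g (g x) = x
      rw [hg (g x), hg x, map_sub, map_smul, hpair_self β hβ, smul_eq_mul]
      module
    intro w hw
    rw [hW] at hw
    induction hw using Subgroup.closure_induction'' with
    | mem g hg => exact hgen g hg
    | inv_mem g hg => rw [hinv g hg]; exact hgen g hg
    | one => intro x _; simp
    | mul a b _ _ iha ihb =>
      intro x hx
      have h1 := ihb x hx
      have h2 := iha (b x) (hPadd x _ hx h1)
      have := add_mem h2 h1
      rw [sub_add_sub_cancel] at this
      exact this
  have hdQ : ∀ x : E, (∀ β ∈ Δ, ∃ m : ℤ, pairing β x = (m : ℝ)) →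
      dmin x - x ∈ AddSubgroup.closure (Set.range α) := by
    intro x hx
    obtain ⟨w, hw, h⟩ := hdmin_orbit x
    rw [h]
    exact hWQ w hw x hx
  -- cone intersected with the lattice
  have hKQ : ∀ x ∈ K, x ∈ AddSubgroup.closure (Set.range α) →
      x ∈ AddSubmonoid.closure (Set.range α) := by
    intro x hxK hxQ
    obtain ⟨c, hc⟩ := (Submodule.mem_span_range_iff_exists_fun NNReal).1 hxK
    rw [← Submodule.span_int_eq_addSubgroupClosure] at hxQ
    obtain ⟨z, hz⟩ := (Submodule.mem_span_range_iff_exists_fun ℤ).1 hxQ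
    have hcz : ∀ i, ((c i : ℝ)) = (z i : ℝ) := by
      have h0 : ∑ i, ((c i : ℝ) - (z i : ℝ)) • α i = 0 := by
        simp only [sub_smul, Finset.sum_sub_distrib, Int.cast_smul_eq_zsmul]
        rw [hz, sub_eq_zero, ← hc]
        rfl
      intro i
      exact sub_eq_zero.1 (Fintype.linearIndependent_iff.1 hαindep _ h0 i)
    rw [← hz]
    refine sum_mem fun i _ => ?_
    have hzi : 0 ≤ z i := by
      have : (0 : ℝ) ≤ z i := by rw [← hcz]; exact (c i).2
      exact_mod_cast this
    obtain ⟨n, hn⟩ := Int.eq_ofNat_of_zero_le hzi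
    rw [hn, natCast_zsmul]
    exact nsmul_mem (AddSubmonoid.subset_closure (Set.mem_range_self i)) n
  have hcher' : ∀ x y : E, cherLE x y ↔ dmin x - dmin y ∈ AddSubmonoid.closure (Set.range α) := by
    intro x y
    rw [hcher]
    constructor
    · rintro (h | ⟨h, -⟩)
      · exact h
      · rw [h, sub_self]; exact zero_mem _
    · exact Or.inl
  have hQle : ∀ x ∈ AddSubmonoid.closure (Set.range α), x ∈ AddSubgroup.closure (Set.range α) := by
    intro x hx
    have : AddSubmonoid.closure (Set.range α) ≤
        (AddSubgroup.closure (Set.range α)).toAddSubmonoid :=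
      (AddSubmonoid.closure_le).2 AddSubgroup.subset_closure
    exact this hx
  simp only [hcher']
  apply Set.Subset.antisymm
  · intro μ hμ
    refine ⟨subset_convexHull ℝ _ hμ, μ - lam, ?_, by abel⟩
    have h1 := hdQ μ hμ.1
    have h2 := hdQ lam hlam
    have h3 := hQle _ hμ.2
    have h4 := add_mem (sub_mem h3 h1) h2
    have h5 : dmin μ - dmin lam - (dmin μ - μ) + (dmin lam - lam) = μ - lam := by abel
    rwa [h5] at h4
  · rintro x ⟨hx, q, hq, hxq⟩
    have hxP : ∀ β ∈ Δ, ∃ m : ℤ, pairing β x = (m : ℝ) := by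
      intro β hβ
      obtain ⟨a, ha⟩ := hlam β hβ
      obtain ⟨b, hb⟩ := hQP q hq β hβ
      exact ⟨a + b, by rw [hxq, map_add, ha, hb]; push_cast; rfl⟩
    refine ⟨hxP, hKQ _ ?_ ?_⟩
    · obtain ⟨w, hw, hwx⟩ := hdmin_orbit x
      have hconv : Convex ℝ {y : E | w y - dmin lam ∈ K} := by
        intro y hy z hz a b ha hb hab
        show w (a • y + b • z) - dmin lam ∈ K
        have : w (a • y + b • z) - dmin lam = a • (w y - dmin lam) + b • (w z - dmin lam) := by
          have hb' : b = 1 - a := by linarith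
          rw [map_add, map_smul, map_smul, hb']
          module
        rw [this]
        exact K.add_mem (hKsmul a ha _ hy) (hKsmul b hb _ hz)
      have hsub := convexHull_min (s := {μ | μ ∈ {x : E | ∀ β ∈ Δ, ∃ m : ℤ, pairing β x = (m : ℝ)} ∧
        dmin μ - dmin lam ∈ AddSubmonoid.closure (Set.range α)}) ?_ hconv
      · rw [hwx]; exact hsub hx
      · rintro μ ⟨-, hμ⟩
        show w μ - dmin lam ∈ K
        have h1 := hlow (w μ)
        rw [hdW μ w hw] at h1
        have := K.add_mem h1 (hQK _ hμ)
        rwa [sub_add_sub_cancel] at this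
    · have h1 := hdQ x hxP
      have h2 := hdQ lam hlam
      have h4 := sub_mem (add_mem h1 hq) h2
      have h5 : dmin x - x + q - (dmin lam - lam) = dmin x - dmin lam := by rw [hxq]; abel
      rwa [h5] at h4
end

section
/- Let λ ∈ P⁺ be a dominant weight with ⟨ϑ∨, λ⟩ ≤ k (i.e. λ corresponds to a level-k dominant affine weight). If w ≤ v in the Bruhat order of W_af, then w ⋅_k λ ⪯ v ⋅_k λ in the Cherednik order on P. -/
/-!
Statement 2.

Setup: `E` is the real span of the weight lattice of a finite-dimensional simple
complex Lie algebra, `Δ` its positive roots, `α : ι → E` the simple roots,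
`pairing β = ⟨β∨, ·⟩`, `θ` the highest root, `W` the Weyl group, `P` the weight
lattice, `Qplus = Σᵢ ℕ αᵢ`, `dmin : λ ↦ λ₋`, and `cherLE` the Cherednik order.

We realize the affine Weyl group `W_af = W ⋉ Q` at level `k` concretely through its
(faithful) level-`k` action on `E`: the simple affine reflections are
`s_i : x ↦ x - ⟨αᵢ∨, x⟩ αᵢ` for `i ∈ ι` and `s_0 : x ↦ s_θ(x) + kθ`; an element of
`W_af` is a composition of these generators, a reduced word for it is a shortest
word expressing it, and the Bruhat order is defined through subwords of reduced
words.

Claim: if `λ ∈ P⁺` with `⟨θ∨, λ⟩ ≤ k` (i.e. `λ` corresponds to a level-`k` dominant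
affine weight) and `w ≤ v` in the Bruhat order of `W_af`, then
`w ⋅_k λ ⪯ v ⋅_k λ` in the Cherednik order.
-/

/-- The reflection `x ↦ x - ⟨β∨, x⟩ β` in the root `β`. -/
def sRefl {E : Type} [AddCommGroup E] [Module ℝ E]
    (pairing : E → E →ₗ[ℝ] ℝ) (β : E) : E → E :=
  fun x => x - pairing β x • β

/-- The simple generators `s_0, s_1, …, s_n` of the affine Weyl group `W_af = W ⋉ Q`
acting on `E` at level `k`: `s_i` for `i ∈ ι` is the simple reflection in `αᵢ`, and
`s_0 = (s_θ, -θ)` acts by `x ↦ s_θ(x) + kθ`. -/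
def affGen {E : Type} [AddCommGroup E] [Module ℝ E] {ι : Type}
    (pairing : E → E →ₗ[ℝ] ℝ) (α : ι → E) (θ : E) (k : ℕ) :
    Option ι → E → E
  | none => fun x => sRefl pairing θ x + (k : ℝ) • θ
  | some i => sRefl pairing (α i)

/-- The element of the affine Weyl group given by a word in the simple generators. -/
def wordProd {E : Type} [AddCommGroup E] [Module ℝ E] {ι : Type}
    (pairing : E → E →ₗ[ℝ] ℝ) (α : ι → E) (θ : E) (k : ℕ)
    (l : List (Option ι)) : E → E :=
  l.foldr (fun i g => affGen pairing α θ k i ∘ g) id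

/-- A word is reduced if no strictly shorter word has the same product. -/
def IsReducedWord {E : Type} [AddCommGroup E] [Module ℝ E] {ι : Type}
    (pairing : E → E →ₗ[ℝ] ℝ) (α : ι → E) (θ : E) (k : ℕ)
    (l : List (Option ι)) : Prop :=
  ∀ l' : List (Option ι),
    wordProd pairing α θ k l' = wordProd pairing α θ k l → l.length ≤ l'.length

/-- Bruhat order on the affine Weyl group: `w ≤ v` iff some reduced word for `v`
admits an (ordered) subword which is a reduced word for `w`. -/
def AffBruhatLE {E : Type} [AddCommGroup E] [Module ℝ E] {ι : Type}
    (pairing : E → E →ₗ[ℝ] ℝ) (α : ι → E) (θ : E) (k : ℕ)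
    (w v : E → E) : Prop :=
  ∃ lv : List (Option ι), wordProd pairing α θ k lv = v ∧
    IsReducedWord pairing α θ k lv ∧
    ∃ lw : List (Option ι), lw.Sublist lv ∧ wordProd pairing α θ k lw = w ∧
      IsReducedWord pairing α θ k lw

set_option linter.unusedSectionVars false
set_option linter.unusedVariables false

noncomputable section
namespace CherAux

variable {E : Type} [AddCommGroup E] [Module ℝ E] {ι : Type} [Fintype ι]

/-- real cone spanned by the simple roots -/
def Cone (α : ι → E) (x : E) : Prop :=
  ∃ c : ι → ℝ, (∀ i, 0 ≤ c i) ∧ x = ∑ i, c i • α i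

theorem Cone.add {α : ι → E} {x y : E} (hx : Cone α x) (hy : Cone α y) : Cone α (x + y) := by
  obtain ⟨c, hc, rfl⟩ := hx
  obtain ⟨d, hd, rfl⟩ := hy
  refine ⟨fun i => c i + d i, fun i => add_nonneg (hc i) (hd i), ?_⟩
  rw [← Finset.sum_add_distrib]
  exact Finset.sum_congr rfl fun i _ => (add_smul _ _ _).symm

theorem Cone.smul {α : ι → E} {x : E} (hx : Cone α x) {r : ℝ} (hr : 0 ≤ r) : Cone α (r • x) := by
  obtain ⟨c, hc, rfl⟩ := hx
  refine ⟨fun i => r * c i, fun i => mul_nonneg hr (hc i), ?_⟩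
  rw [Finset.smul_sum]
  exact Finset.sum_congr rfl fun i _ => smul_smul _ _ _

theorem coord_eq {α : ι → E} (h : LinearIndependent ℝ α) {c d : ι → ℝ}
    (e : ∑ i, c i • α i = ∑ i, d i • α i) (i : ι) : c i = d i := by
  have h1 := Fintype.linearIndependent_iff.1 h (fun i => c i - d i) (by
    simp only [sub_smul, Finset.sum_sub_distrib, e, sub_self]) i
  linarith

theorem Cone.antisymm {α : ι → E} (h : LinearIndependent ℝ α) {x : E}
    (hx : Cone α x) (hy : Cone α (-x)) : x = 0 := by
  obtain ⟨c, hc, rfl⟩ := hx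
  obtain ⟨d, hd, e⟩ := hy
  have e' : ∑ i, c i • α i = ∑ i, (- d i) • α i := by
    simp only [neg_smul, Finset.sum_neg_distrib, ← e, neg_neg]
  apply Finset.sum_eq_zero
  intro i _
  have := coord_eq h e' i
  have h1 := hc i
  have h2 := hd i
  have : c i = 0 := by linarith
  simp [this]

theorem nat_coord {α : ι → E} {x : E} (hx : x ∈ AddSubmonoid.closure (Set.range α)) :
    ∃ n : ι → ℕ, x = ∑ i, (n i : ℝ) • α i := by
  classical
  induction hx using AddSubmonoid.closure_induction with
  | mem x hx =>
    obtain ⟨i, rfl⟩ := hx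
    refine ⟨fun j => if j = i then 1 else 0, ?_⟩
    simp
  | zero => exact ⟨fun _ => 0, by simp⟩
  | add x y _ _ hx hy =>
    obtain ⟨n, rfl⟩ := hx
    obtain ⟨m, rfl⟩ := hy
    refine ⟨fun i => n i + m i, ?_⟩
    simp [add_smul, Finset.sum_add_distrib]

theorem int_coord {α : ι → E} {x : E} (hx : x ∈ AddSubgroup.closure (Set.range α)) :
    ∃ n : ι → ℤ, x = ∑ i, (n i : ℝ) • α i := by
  classical
  induction hx using AddSubgroup.closure_induction with
  | mem x hx =>
    obtain ⟨i, rfl⟩ := hx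
    refine ⟨fun j => if j = i then 1 else 0, ?_⟩
    simp
  | zero => exact ⟨fun _ => 0, by simp⟩
  | add x y _ _ hx hy =>
    obtain ⟨n, rfl⟩ := hx
    obtain ⟨m, rfl⟩ := hy
    refine ⟨fun i => n i + m i, ?_⟩
    simp [add_smul, Finset.sum_add_distrib]
  | neg x _ hx =>
    obtain ⟨n, rfl⟩ := hx
    refine ⟨fun i => - n i, ?_⟩
    simp

theorem cone_of_mem {α : ι → E} {x : E} (hx : x ∈ AddSubmonoid.closure (Set.range α)) :
    Cone α x := by
  obtain ⟨n, rfl⟩ := nat_coord hx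
  exact ⟨fun i => n i, fun i => Nat.cast_nonneg _, rfl⟩

theorem mem_of_cone {α : ι → E} (h : LinearIndependent ℝ α) {x : E}
    (hx : Cone α x) (hq : x ∈ AddSubgroup.closure (Set.range α)) :
    x ∈ AddSubmonoid.closure (Set.range α) := by
  obtain ⟨c, hc, rfl⟩ := hx
  obtain ⟨n, e⟩ := int_coord hq
  apply sum_mem
  intro i _
  have hi := coord_eq h e i
  have h0 : 0 ≤ n i := by
    have := hc i
    rw [hi] at this
    exact_mod_cast this
  obtain ⟨m, hm⟩ := Int.eq_ofNat_of_zero_le h0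
  rw [hi, hm]
  have : ((m : ℤ) : ℝ) • α i = m • α i := by
    rw [← Nat.cast_smul_eq_nsmul ℝ]; simp
  rw [this]
  exact AddSubmonoid.nsmul_mem _ (AddSubmonoid.subset_closure (Set.mem_range_self i)) m

theorem mem_Q_of_mem {α : ι → E} {x : E} (hx : x ∈ AddSubmonoid.closure (Set.range α)) :
    x ∈ AddSubgroup.closure (Set.range α) :=
  (AddSubmonoid.closure_le (S := (AddSubgroup.closure (Set.range α)).toAddSubmonoid)).2
    AddSubgroup.subset_closure hx

/-- reflection written through an invariant form -/
def sR (B : E →ₗ[ℝ] E →ₗ[ℝ] ℝ) (β x : E) : E := x - (2 * B β x / B β β) • β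

/-- a root datum with a normalized invariant form -/
structure RD (Δ : Finset E) (α : ι → E) (θ : E) (B : E →ₗ[ℝ] E →ₗ[ℝ] ℝ) : Prop where
  symm : ∀ x y, B x y = B y x
  pos : ∀ β ∈ Δ, 0 < B β β
  hα : ∀ i, α i ∈ Δ
  indep : LinearIndependent ℝ α
  hpos : ∀ β ∈ Δ, β ∈ AddSubmonoid.closure (Set.range α)
  refl : ∀ β ∈ Δ, ∀ γ ∈ Δ, sR B β γ ∈ Δ ∨ -(sR B β γ) ∈ Δ
  crys : ∀ β ∈ Δ, ∀ γ ∈ Δ, ∃ m : ℤ, 2 * B β γ / B β β = m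
  hθ : θ ∈ Δ
  norm : B θ θ = 2
  high : ∀ β ∈ Δ, θ - β ∈ AddSubmonoid.closure (Set.range α)

/-- affine generators -/
def gen (B : E →ₗ[ℝ] E →ₗ[ℝ] ℝ) (α : ι → E) (θ : E) (k : ℝ) : Option ι → E → E
  | none => fun x => sR B θ x + k • θ
  | some i => sR B (α i)

/-- product of a word of affine generators -/
def word (B : E →ₗ[ℝ] E →ₗ[ℝ] ℝ) (α : ι → E) (θ : E) (k : ℝ) : List (Option ι) → E → E
  | [] => id
  | o :: L => gen B α θ k o ∘ word B α θ k L

/-- value of the affine root `(b, m)` -/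
def ev (B : E →ₗ[ℝ] E →ₗ[ℝ] ℝ) (k : ℝ) (φ : E × ℝ) (x : E) : ℝ := B φ.1 x + φ.2 * k

/-- reflection of an affine root -/
def tR (B : E →ₗ[ℝ] E →ₗ[ℝ] ℝ) (k : ℝ) (φ : E × ℝ) (x : E) : E :=
  x - (2 * ev B k φ x / B φ.1 φ.1) • φ.1

/-- action of the generators on affine roots -/
def act (B : E →ₗ[ℝ] E →ₗ[ℝ] ℝ) (α : ι → E) (θ : E) : Option ι → E × ℝ → E × ℝ
  | none, φ => (sR B θ φ.1, φ.2 + B φ.1 θ)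
  | some i, φ => (sR B (α i) φ.1, φ.2)

/-- simple affine roots -/
def simp0 (α : ι → E) (θ : E) : Option ι → E × ℝ
  | none => (-θ, 1)
  | some i => (α i, 0)

/-- positive affine roots -/
def Pos (Δ : Finset E) (φ : E × ℝ) : Prop :=
  (φ.1 ∈ Δ ∨ -φ.1 ∈ Δ) ∧ (∃ n : ℤ, φ.2 = n) ∧ (1 ≤ φ.2 ∨ (φ.2 = 0 ∧ φ.1 ∈ Δ))

theorem sR_add (B : E →ₗ[ℝ] E →ₗ[ℝ] ℝ) (β x y : E) : sR B β (x + y) = sR B β x + sR B β y := by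
  simp only [sR, map_add, mul_add, add_div, add_smul]; abel

theorem sR_smul (B : E →ₗ[ℝ] E →ₗ[ℝ] ℝ) (β x : E) (r : ℝ) : sR B β (r • x) = r • sR B β x := by
  simp only [sR, map_smul, smul_eq_mul, smul_sub, smul_smul]; congr 2; ring

theorem sR_neg (B : E →ₗ[ℝ] E →ₗ[ℝ] ℝ) (β x : E) : sR B β (-x) = - sR B β x := by
  have := sR_smul B β x (-1); simpa using this

theorem sR_sub (B : E →ₗ[ℝ] E →ₗ[ℝ] ℝ) (β x y : E) : sR B β (x - y) = sR B β x - sR B β y := by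
  rw [sub_eq_add_neg, sR_add, sR_neg, sub_eq_add_neg]

theorem sR_negroot (B : E →ₗ[ℝ] E →ₗ[ℝ] ℝ) (β x : E) : sR B (-β) x = sR B β x := by
  simp [sR, neg_div]

theorem sR_smulroot (B : E →ₗ[ℝ] E →ₗ[ℝ] ℝ) (β x : E) {r : ℝ} (hr : r ≠ 0) :
    sR B (r • β) x = sR B β x := by
  simp only [sR, map_smul, smul_eq_mul, LinearMap.smul_apply, smul_smul]
  congr 2
  by_cases h : B β β = 0
  · simp [h]
  · field_simp

theorem B_sR (B : E →ₗ[ℝ] E →ₗ[ℝ] ℝ) (hs : ∀ x y, B x y = B y x) {β : E} (hβ : B β β ≠ 0)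
    (x y : E) : B (sR B β x) y = B x (sR B β y) := by
  simp only [sR, map_sub, map_smul, LinearMap.sub_apply, LinearMap.smul_apply, smul_eq_mul]
  rw [hs x β]; ring

theorem sR_sR (B : E →ₗ[ℝ] E →ₗ[ℝ] ℝ) {β : E} (hβ : B β β ≠ 0) (x : E) :
    sR B β (sR B β x) = x := by
  simp only [sR, map_sub, map_smul, smul_eq_mul]
  have : 2 * (B β x - 2 * B β x / B β β * B β β) / B β β = - (2 * B β x / B β β) := by
    field_simp; ring
  rw [this]; simp

theorem B_sR_sR (B : E →ₗ[ℝ] E →ₗ[ℝ] ℝ) (hs : ∀ x y, B x y = B y x) {β : E} (hβ : B β β ≠ 0)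
    (x y : E) : B (sR B β x) (sR B β y) = B x y := by
  rw [B_sR B hs hβ, sR_sR B hβ]

section RDsec
variable {Δ : Finset E} {α : ι → E} {θ : E} {B : E →ₗ[ℝ] E →ₗ[ℝ] ℝ}

theorem RD.ne (h : RD Δ α θ B) {β : E} (hβ : β ∈ Δ) : B β β ≠ 0 := (h.pos β hβ).ne'

theorem RD.cone (h : RD Δ α θ B) {β : E} (hβ : β ∈ Δ) : Cone α β := cone_of_mem (h.hpos β hβ)

theorem RD.not_neg (h : RD Δ α θ B) {β : E} (hβ : β ∈ Δ) (hc : Cone α (-β)) : False := by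
  have := Cone.antisymm h.indep (h.cone hβ) hc
  have h2 := h.ne hβ
  simp [this] at h2

theorem RD.theta_ne (h : RD Δ α θ B) : θ ≠ 0 := by
  intro e; have := h.norm; simp [e] at this

theorem RD.sθ (h : RD Δ α θ B) (x : E) : sR B θ x = x - B θ x • θ := by
  unfold sR; rw [h.norm]; congr 2; ring

/-- roots closed under reflections, signed version -/
theorem RD.refl' (h : RD Δ α θ B) {β γ : E} (hβ : β ∈ Δ) (hγ : γ ∈ Δ ∨ -γ ∈ Δ) :
    sR B β γ ∈ Δ ∨ -(sR B β γ) ∈ Δ := by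
  rcases hγ with hγ | hγ
  · exact h.refl β hβ γ hγ
  · have := h.refl β hβ _ hγ
    rw [sR_neg, neg_neg] at this
    exact this.symm

theorem RD.prop_simple (h : RD Δ α θ B) {β : E} (hβ : β ∈ Δ) {i : ι}
    (hn : -(sR B (α i) β) ∈ Δ) : ∃ r : ℝ, r ≠ 0 ∧ β = r • α i := by
  classical
  obtain ⟨c, hc, e⟩ := h.cone hβ
  obtain ⟨d, hd, e'⟩ := h.cone hn
  have e2 : ∑ j, d j • α j = ∑ j, (-c j + if j = i then 2 * B (α i) β / B (α i) (α i) else 0) • α j := by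
    rw [← e']
    simp only [add_smul, Finset.sum_add_distrib, neg_smul, Finset.sum_neg_distrib, ← e]
    simp [sR]
    abel
  have hz : ∀ j, j ≠ i → c j = 0 := by
    intro j hj
    have := coord_eq h.indep e2 j
    simp only [hj, if_false] at this
    have h1 := hc j
    have h2 := hd j
    linarith
  have e3 : β = c i • α i := by
    rw [e]
    rw [Finset.sum_eq_single i]
    · intro j _ hj; simp [hz j hj]
    · simp
  refine ⟨c i, ?_, e3⟩
  intro h0
  have := h.ne hβ
  rw [e3, h0] at this
  simp at this

/-- pairing with the highest coroot is at least 0 -/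
theorem RD.p_int (h : RD Δ α θ B) {β : E} (hβ : β ∈ Δ) : ∃ p : ℤ, B θ β = p := by
  obtain ⟨m, hm⟩ := h.crys θ h.hθ β hβ
  refine ⟨m, ?_⟩
  rw [← hm, h.norm]; ring

theorem RD.p_nonneg (h : RD Δ α θ B) {β : E} (hβ : β ∈ Δ) : 0 ≤ B θ β := by
  by_contra hn
  push Not at hn
  have hle : B θ β ≤ -1 := by
    obtain ⟨p, hp⟩ := h.p_int hβ
    rw [hp] at hn ⊢
    have : p < 0 := by exact_mod_cast hn
    have : p ≤ -1 := by omega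
    exact_mod_cast this
  have hr := h.refl θ h.hθ β hβ
  rw [h.sθ] at hr
  have hθc := h.cone h.hθ
  rcases hr with hr | hr
  · have hc := cone_of_mem (h.high _ hr)
    apply h.not_neg hβ
    have := hc.add (hθc.smul (r := -1 - B θ β) (by linarith))
    convert this using 1
    module
  · apply h.not_neg hβ
    have := (h.cone hr).add (hθc.smul (r := - B θ β) (by linarith))
    convert this using 1
    module

theorem RD.p_le (h : RD Δ α θ B) {β : E} (hβ : β ∈ Δ) : B θ β ≤ 1 ∨ β = θ := by
  by_contra hn
  push Not at hn
  obtain ⟨hn, hne⟩ := hn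
  have hle : 2 ≤ B θ β := by
    obtain ⟨p, hp⟩ := h.p_int hβ
    rw [hp] at hn ⊢
    have : 1 < p := by exact_mod_cast hn
    have : 2 ≤ p := by omega
    exact_mod_cast this
  have hr := h.refl θ h.hθ β hβ
  rw [h.sθ] at hr
  have hθc := h.cone h.hθ
  have hd := cone_of_mem (h.high _ hβ)
  rcases hr with hr | hr
  · apply h.not_neg h.hθ
    have := ((h.cone hr).add hd).add (hθc.smul (r := B θ β - 2) (by linarith))
    convert this using 1
    module
  · apply hne
    have h1 := cone_of_mem (h.high _ hr)
    have h2 : Cone α (-(θ - β)) := by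
      have := h1.add (hθc.smul (r := B θ β - 2) (by linarith))
      convert this using 1
      module
    exact (sub_eq_zero.1 (Cone.antisymm h.indep hd h2)).symm

/-! ### generators -/

theorem RD.gen_gen (h : RD Δ α θ B) (k : ℝ) (o : Option ι) (x : E) :
    gen B α θ k o (gen B α θ k o x) = x := by
  cases o with
  | none =>
    simp only [gen]
    rw [sR_add, sR_sR B (h.ne h.hθ), sR_smul]
    rw [h.sθ θ, h.norm]; module
  | some i => exact sR_sR B (h.ne (h.hα i)) x

theorem RD.ev_act (h : RD Δ α θ B) (k : ℝ) (o : Option ι) (φ : E × ℝ) (x : E) :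
    ev B k (act B α θ o φ) x = ev B k φ (gen B α θ k o x) := by
  cases o with
  | none =>
    simp only [gen, act, ev, B_sR B h.symm (h.ne h.hθ), map_add, map_smul, smul_eq_mul]
    ring
  | some i => simp only [gen, act, ev, B_sR B h.symm (h.ne (h.hα i))]

theorem RD.tR_act (h : RD Δ α θ B) (k : ℝ) (o : Option ι) (φ : E × ℝ) (x : E) :
    tR B k (act B α θ o φ) (gen B α θ k o x) = gen B α θ k o (tR B k φ x) := by
  have e := h.ev_act k o φ (gen B α θ k o x)
  rw [h.gen_gen] at e
  unfold tR
  rw [e]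
  cases o with
  | none =>
    simp only [gen, act, B_sR_sR B h.symm (h.ne h.hθ), sR_sub, sR_smul]
    abel
  | some i =>
    simp only [gen, act, B_sR_sR B h.symm (h.ne (h.hα i)), sR_sub, sR_smul]

theorem RD.tR_simp (h : RD Δ α θ B) (k : ℝ) (o : Option ι) (x : E) :
    tR B k (simp0 α θ o) x = gen B α θ k o x := by
  cases o with
  | none =>
    simp only [gen, simp0, tR, ev, h.sθ, map_neg, LinearMap.neg_apply, h.norm, neg_neg]
    module
  | some i => simp [gen, simp0, tR, ev, sR]

theorem RD.pos_simp (h : RD Δ α θ B) (o : Option ι) : Pos Δ (simp0 α θ o) := by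
  cases o with
  | none => exact ⟨Or.inr (by simpa [simp0] using h.hθ), ⟨1, by simp [simp0]⟩, Or.inl (by simp [simp0])⟩
  | some i => exact ⟨Or.inl (by simpa [simp0] using h.hα i), ⟨0, by simp [simp0]⟩,
      Or.inr ⟨rfl, h.hα i⟩⟩

theorem RD.pos_act (h : RD Δ α θ B) (k : ℝ) (o : Option ι) {φ : E × ℝ} (hφ : Pos Δ φ) :
    Pos Δ (act B α θ o φ) ∨ ∀ x, tR B k φ x = gen B α θ k o x := by
  obtain ⟨b, m⟩ := φ
  obtain ⟨hb, ⟨n, hn⟩, hp⟩ := hφ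
  simp only at hb hn hp
  cases o with
  | some i =>
    have hr := h.refl' (h.hα i) hb
    rcases hp with hp | ⟨hm, hbΔ⟩
    · exact Or.inl ⟨hr, ⟨n, hn⟩, Or.inl hp⟩
    · rcases hr with hr' | hr'
      · exact Or.inl ⟨Or.inl hr', ⟨n, hn⟩, Or.inr ⟨hm, hr'⟩⟩
      · right
        obtain ⟨r, hr0, rfl⟩ := h.prop_simple hbΔ hr'
        intro x
        have := sR_smulroot B (α i) x hr0
        simp only [gen, tR, ev, hm, zero_mul, add_zero]
        exact this
  | none =>
    have hr := h.refl' h.hθ hb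
    by_cases hbΔ : b ∈ Δ
    · left
      obtain ⟨p, hpp⟩ := h.p_int hbΔ
      have p0 := h.p_nonneg hbΔ
      refine ⟨hr, ⟨n + p, by simp [act, hn, h.symm b θ, hpp]⟩, ?_⟩
      simp only [act, h.symm b θ]
      rcases hp with hp | ⟨hm, -⟩
      · left; linarith
      · rw [hm, hpp, zero_add]
        rw [hpp] at p0
        have p0' : 0 ≤ p := by exact_mod_cast p0
        rcases p0'.eq_or_lt with h0 | h0
        · right
          refine ⟨by simp [← h0], ?_⟩
          rw [h.sθ, hpp, ← h0]; simpa using hbΔ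
        · left; exact_mod_cast h0
    · have hnb : -b ∈ Δ := hb.resolve_left hbΔ
      have hm1 : 1 ≤ m := hp.resolve_right (fun hh => hbΔ hh.2)
      have hn1 : 1 ≤ n := by rw [hn] at hm1; exact_mod_cast hm1
      obtain ⟨p, hpp⟩ := h.p_int hnb
      have eB : B b θ = -(p : ℝ) := by rw [h.symm, ← hpp]; simp
      rcases h.p_le hnb with hle | heq
      · left
        refine ⟨hr, ⟨n - p, by simp [act, hn, eB]; ring⟩, ?_⟩
        simp only [act, eB, hn]
        have hp1 : p ≤ 1 := by rw [hpp] at hle; exact_mod_cast hle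
        rcases (show 1 ≤ n - p ∨ (n = 1 ∧ p = 1) by omega) with h1 | ⟨h1, h2⟩
        · left
          have : ((1 : ℤ) : ℝ) ≤ ((n - p : ℤ) : ℝ) := by exact_mod_cast h1
          push_cast at this; linarith
        · right
          refine ⟨by simp [h1, h2], ?_⟩
          have e : sR B θ b = θ - (-b) := by
            rw [h.sθ, h.symm, eB, h2]; simp; abel
          have hc := cone_of_mem (h.high _ hnb)
          rcases hr with hr | hr
          · exact hr
          · rw [e] at hr
            exact (h.not_neg hr (by rwa [neg_neg])).elim
      · have eb : b = -θ := by rw [← heq, neg_neg]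
        have hp2 : p = 2 := by
          rw [heq, h.norm] at hpp; exact_mod_cast hpp.symm
        rcases (show n = 1 ∨ n = 2 ∨ 3 ≤ n by omega) with h1 | h1 | h1
        · right
          intro x
          rw [eb, hn, h1]
          have := h.tR_simp k none x
          simpa [simp0] using this
        · left
          refine ⟨hr, ⟨n - p, by simp [act, hn, eB]; ring⟩, Or.inr ⟨by simp [act, eB, hn, h1, hp2], ?_⟩⟩
          simp only [act]
          rw [eb, sR_neg, h.sθ, h.norm]
          convert h.hθ using 1
          module
        · left
          refine ⟨hr, ⟨n - p, by simp [act, hn, eB]; ring⟩, Or.inl ?_⟩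
          have : ((3 : ℤ) : ℝ) ≤ (n : ℝ) := by exact_mod_cast h1
          simp only [act, eB, hn, hp2]
          push_cast at this ⊢; linarith

/-- action of a word on affine roots -/
def actW (B : E →ₗ[ℝ] E →ₗ[ℝ] ℝ) (α : ι → E) (θ : E) : List (Option ι) → E × ℝ → E × ℝ
  | [], φ => φ
  | o :: L, φ => act B α θ o (actW B α θ L φ)

theorem RD.tR_actW (h : RD Δ α θ B) (k : ℝ) (L : List (Option ι)) (φ : E × ℝ) (x : E) :
    tR B k (actW B α θ L φ) (word B α θ k L x) = word B α θ k L (tR B k φ x) := by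
  induction L with
  | nil => rfl
  | cons o L ih =>
    simp only [actW, word, Function.comp]
    rw [h.tR_act, ih]

theorem RD.exchange (h : RD Δ α θ B) (k : ℝ) (L : List (Option ι)) (i : Option ι) :
    Pos Δ (actW B α θ L (simp0 α θ i)) ∨
    ∃ L' : List (Option ι), L'.Sublist L ∧ L'.length + 1 = L.length ∧
      ∀ x, word B α θ k L' x = word B α θ k L (gen B α θ k i x) := by
  induction L with
  | nil => exact Or.inl (h.pos_simp i)
  | cons o T ih =>
    rcases ih with ih | ⟨L', h1, h2, h3⟩
    · rcases h.pos_act k o ih with h1 | h1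
      · exact Or.inl h1
      · right
        refine ⟨T, List.sublist_cons_self _ _, rfl, fun x => ?_⟩
        simp only [word, Function.comp]
        rw [← h.tR_simp k i, ← h.tR_actW, h1, h.gen_gen]
    · right
      exact ⟨o :: L', h1.cons_cons o, by simp [h2], fun x => by simp [word, h3]⟩

theorem word_append (B : E →ₗ[ℝ] E →ₗ[ℝ] ℝ) (α : ι → E) (θ : E) (k : ℝ)
    (L M : List (Option ι)) (x : E) :
    word B α θ k (L ++ M) x = word B α θ k L (word B α θ k M x) := by
  induction L with
  | nil => rfl
  | cons o L ih => simp [word, ih]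

theorem RD.word_reverse (h : RD Δ α θ B) (k : ℝ) (L : List (Option ι)) (x : E) :
    word B α θ k L.reverse (word B α θ k L x) = x := by
  induction L generalizing x with
  | nil => rfl
  | cons o L ih =>
    simp only [List.reverse_cons, word_append]
    simp only [word, Function.comp, id, h.gen_gen, ih]

theorem RD.word_reverse' (h : RD Δ α θ B) (k : ℝ) (L : List (Option ι)) (x : E) :
    word B α θ k L (word B α θ k L.reverse x) = x := by
  have := h.word_reverse k L.reverse x
  rwa [List.reverse_reverse] at this

theorem RD.ev_actW (h : RD Δ α θ B) (k : ℝ) (L : List (Option ι)) (φ : E × ℝ) (x : E) :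
    ev B k (actW B α θ L φ) x = ev B k φ (word B α θ k L.reverse x) := by
  induction L generalizing x with
  | nil => rfl
  | cons o L ih =>
    simp only [actW, List.reverse_cons, word_append, h.ev_act, ih]
    rfl

/-- positive affine roots are nonnegative on the closed fundamental alcove -/
theorem RD.ev_nonneg (h : RD Δ α θ B) {k : ℝ} (hk : 0 < k) {lam : E}
    (hd : ∀ β ∈ Δ, 0 ≤ B β lam) (hl : B θ lam ≤ k) {φ : E × ℝ} (hφ : Pos Δ φ) :
    0 ≤ ev B k φ lam := by
  obtain ⟨b, m⟩ := φ
  obtain ⟨hb, -, hp⟩ := hφ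
  simp only [ev] at *
  rcases hp with hp | ⟨hm, hbΔ⟩
  · have h1 : k ≤ m * k := by nlinarith
    rcases hb with hb | hb
    · have := hd b hb; linarith
    · have h2 : 0 ≤ B (θ - (-b)) lam := by
        obtain ⟨c, hc, e⟩ := cone_of_mem (h.high _ hb)
        rw [e]
        simp only [map_sum, map_smul, LinearMap.sum_apply, LinearMap.smul_apply, smul_eq_mul]
        exact Finset.sum_nonneg fun i _ => mul_nonneg (hc i) (hd _ (h.hα i))
      simp only [sub_neg_eq_add, map_add, LinearMap.add_apply] at h2
      linarith
  · rw [hm]; have := hd b hbΔ; linarith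

theorem RD.side (h : RD Δ α θ B) {k : ℝ} (hk : 0 < k) {lam : E}
    (hd : ∀ β ∈ Δ, 0 ≤ B β lam) (hl : B θ lam ≤ k) {o : Option ι} {L : List (Option ι)}
    (hred : ∀ M, (∀ x, word B α θ k M x = word B α θ k (o :: L) x) → (o :: L).length ≤ M.length) :
    0 ≤ ev B k (simp0 α θ o) (word B α θ k L lam) := by
  rcases h.exchange k L.reverse o with hp | ⟨M, -, h2, h3⟩
  · have := h.ev_nonneg hk hd hl hp
    rwa [h.ev_actW, List.reverse_reverse] at this
  · exfalso
    have := hred M.reverse (fun x => by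
      have e : x = word B α θ k M (word B α θ k (o :: L) x) := by
        rw [h3]
        simp only [word, Function.comp, h.gen_gen, h.word_reverse]
      conv_lhs => rw [e]
      rw [h.word_reverse])
    simp at this h2
    omega


/-! ### finite words -/

/-- product of a word in the finite simple reflections -/
def fw (B : E →ₗ[ℝ] E →ₗ[ℝ] ℝ) (α : ι → E) (L : List ι) : E → E :=
  word B α 0 0 (L.map some)

theorem word_map (B : E →ₗ[ℝ] E →ₗ[ℝ] ℝ) (α : ι → E) (θ : E) (k : ℝ) (L : List ι) (x : E) :
    word B α θ k (L.map some) x = fw B α L x := by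
  induction L with
  | nil => rfl
  | cons i L ih =>
    unfold fw at *
    simp only [List.map_cons, word, Function.comp, ih, gen]

theorem fw_cons (B : E →ₗ[ℝ] E →ₗ[ℝ] ℝ) (α : ι → E) (i : ι) (L : List ι) (x : E) :
    fw B α (i :: L) x = sR B (α i) (fw B α L x) := rfl

theorem fw_append (B : E →ₗ[ℝ] E →ₗ[ℝ] ℝ) (α : ι → E) (L M : List ι) (x : E) :
    fw B α (L ++ M) x = fw B α L (fw B α M x) := by
  unfold fw; rw [List.map_append, word_append]

theorem RD.fw_reverse (h : RD Δ α θ B) (L : List ι) (x : E) :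
    fw B α L.reverse (fw B α L x) = x := by
  rw [← word_map B α θ 0, ← word_map B α θ 0, List.map_reverse, h.word_reverse]

theorem fw_add (B : E →ₗ[ℝ] E →ₗ[ℝ] ℝ) (α : ι → E) (L : List ι) (x y : E) :
    fw B α L (x + y) = fw B α L x + fw B α L y := by
  induction L with
  | nil => rfl
  | cons i L ih => rw [fw_cons, ih, sR_add, ← fw_cons, ← fw_cons]

theorem fw_smul (B : E →ₗ[ℝ] E →ₗ[ℝ] ℝ) (α : ι → E) (L : List ι) (r : ℝ) (x : E) :
    fw B α L (r • x) = r • fw B α L x := by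
  induction L with
  | nil => rfl
  | cons i L ih => rw [fw_cons, ih, sR_smul, ← fw_cons]

theorem fw_neg (B : E →ₗ[ℝ] E →ₗ[ℝ] ℝ) (α : ι → E) (L : List ι) (x : E) :
    fw B α L (-x) = - fw B α L x := by
  have := fw_smul B α L (-1) x; simpa using this

theorem fw_sub (B : E →ₗ[ℝ] E →ₗ[ℝ] ℝ) (α : ι → E) (L : List ι) (x y : E) :
    fw B α L (x - y) = fw B α L x - fw B α L y := by
  rw [sub_eq_add_neg, fw_add, fw_neg, sub_eq_add_neg]

theorem actW_map (B : E →ₗ[ℝ] E →ₗ[ℝ] ℝ) (α : ι → E) (θ : E) (L : List ι) (φ : E × ℝ) :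
    actW B α θ (L.map some) φ = (fw B α L φ.1, φ.2) := by
  induction L with
  | nil => rfl
  | cons i L ih => simp only [List.map_cons, actW, ih, act, fw_cons]

theorem RD.fw_root (h : RD Δ α θ B) (L : List ι) {b : E} (hb : b ∈ Δ ∨ -b ∈ Δ) :
    fw B α L b ∈ Δ ∨ -(fw B α L b) ∈ Δ := by
  induction L with
  | nil => exact hb
  | cons i L ih => exact h.refl' (h.hα i) ih

/-- an antidominant element is the lowest one of its orbit -/
theorem RD.fin_ge (h : RD Δ α θ B) {a : E} (ha : ∀ i, B (α i) a ≤ 0) :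
    ∀ (n : ℕ) (L : List ι), L.length = n → Cone α (fw B α L a - a) := by
  intro n
  induction n using Nat.strong_induction_on with
  | _ n ih =>
    intro L hL
    rcases List.eq_nil_or_concat L with rfl | ⟨T, i, rfl⟩
    · refine ⟨fun _ => 0, fun _ => le_rfl, ?_⟩
      simp [fw, word]
    · simp only [List.concat_eq_append] at *
      simp at hL
      rcases h.exchange 0 (T.map some) (some i) with hp | ⟨L', h1, h2, h3⟩
      · rw [actW_map] at hp
        have hr : fw B α T (α i) ∈ Δ := by
          rcases hp.2.2 with h1 | h1
          · simp [simp0] at h1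
            norm_num at h1
          · exact h1.2
        have hT := ih T.length (by omega) T rfl
        have e : fw B α (T ++ [i]) a - a = (fw B α T a - a) +
            (-(2 * B (α i) a / B (α i) (α i))) • fw B α T (α i) := by
          rw [fw_append]
          change fw B α T (sR B (α i) a) - a = _
          rw [sR, fw_sub, fw_smul]; module
        rw [e]
        refine hT.add ((h.cone hr).smul ?_)
        rw [← neg_div]
        exact div_nonneg (by linarith [ha i]) (h.pos _ (h.hα i)).le
      · obtain ⟨M, hM, rfl⟩ := List.sublist_map_iff.1 h1
        simp at h2
        have := ih M.length (by omega) M rfl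
        have e : fw B α (T ++ [i]) a = fw B α M a := by
          have := h3 a
          rw [word_map, word_map] at this
          rw [this, fw_append]; rfl
        rw [e]; exact this

/-- every reflection is a word in the simple reflections -/
theorem RD.refl_word (h : RD Δ α θ B) : ∀ (N : ℕ) (β : E), β ∈ Δ →
    (∃ n : ι → ℕ, β = ∑ i, (n i : ℝ) • α i ∧ ∑ i, n i = N) →
    ∃ L : List ι, ∀ x, sR B β x = fw B α L x := by
  classical
  intro N
  induction N using Nat.strong_induction_on with
  | _ N ih =>
    rintro β hβ ⟨n, e, hN⟩
    have hpos : 0 < ∑ i, (n i : ℝ) * B (α i) β := by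
      have := h.pos β hβ
      have e2 : B β β = ∑ i, (n i : ℝ) * B (α i) β := by
        conv_lhs => rw [show B β = B (∑ i, (n i : ℝ) • α i) by rw [← e]]
        simp only [map_sum, map_smul, LinearMap.sum_apply, LinearMap.smul_apply, smul_eq_mul]
      rwa [e2] at this
    obtain ⟨j, -, hj⟩ := Finset.exists_lt_of_sum_lt (s := Finset.univ) (f := fun _ : ι => (0 : ℝ))
      (by simpa using hpos)
    have hBj : 0 < B (α j) β := by
      by_contra hc
      push Not at hc
      have : (n j : ℝ) * B (α j) β ≤ 0 := mul_nonpos_of_nonneg_of_nonpos (Nat.cast_nonneg _) hc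
      linarith
    rcases h.refl _ (h.hα j) β hβ with hr | hr
    · obtain ⟨n', e'⟩ := nat_coord (h.hpos _ hr)
      set c := 2 * B (α j) β / B (α j) (α j) with hc
      have hc0 : 0 < c := div_pos (by linarith) (h.pos _ (h.hα j))
      have e2 : ∑ i, (n' i : ℝ) • α i = ∑ i, ((n i : ℝ) - if i = j then c else 0) • α i := by
        rw [← e']
        simp only [sub_smul, Finset.sum_sub_distrib, ← e]
        simp [sR, hc]
      have hlt : ∑ i, n' i < N := by
        have : (∑ i, (n' i : ℝ)) < ∑ i, (n i : ℝ) := by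
          rw [Finset.sum_congr rfl fun i _ => coord_eq h.indep e2 i]
          rw [Finset.sum_sub_distrib]
          simp [hc0]
        rw [← hN]
        exact_mod_cast this
      obtain ⟨L, hL⟩ := ih _ hlt _ hr ⟨n', e', rfl⟩
      refine ⟨j :: (L ++ [j]), fun x => ?_⟩
      rw [fw_cons, fw_append]
      change _ = sR B (α j) (fw B α L (sR B (α j) x))
      rw [← hL]
      have hne := h.ne (h.hα j)
      have e3 : sR B (sR B (α j) β) (sR B (α j) x) = sR B (α j) (sR B β x) := by
        conv_lhs => rw [sR]
        rw [B_sR_sR B h.symm hne, B_sR_sR B h.symm hne]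
        conv_rhs => rw [sR.eq_def B β x, sR_sub, sR_smul]
      rw [e3, sR_sR B hne]
    · obtain ⟨r, hr0, e'⟩ := h.prop_simple hβ hr
      refine ⟨[j], fun x => ?_⟩
      rw [e', sR_smulroot B _ _ hr0]; rfl

theorem RD.refl_word' (h : RD Δ α θ B) {β : E} (hβ : β ∈ Δ) :
    ∃ L : List ι, ∀ x, sR B β x = fw B α L x := by
  obtain ⟨n, e⟩ := nat_coord (h.hpos β hβ)
  exact h.refl_word _ β hβ ⟨n, e, rfl⟩

/-! ### lattices -/

/-- weight lattice -/
def IsP (B : E →ₗ[ℝ] E →ₗ[ℝ] ℝ) (Δ : Finset E) (x : E) : Prop :=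
  ∀ β ∈ Δ, ∃ m : ℤ, 2 * B β x / B β β = m

theorem RD.isP_root (h : RD Δ α θ B) {x : E} (hx : x ∈ AddSubgroup.closure (Set.range α)) :
    IsP B Δ x := by
  intro β hβ
  induction hx using AddSubgroup.closure_induction with
  | mem x hx => obtain ⟨i, rfl⟩ := hx; exact h.crys β hβ _ (h.hα i)
  | zero => exact ⟨0, by simp⟩
  | add x y _ _ hx hy =>
    obtain ⟨n, hn⟩ := hx
    obtain ⟨m, hm⟩ := hy
    exact ⟨n + m, by push_cast; rw [← hn, ← hm, map_add]; ring⟩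
  | neg x _ hx =>
    obtain ⟨n, hn⟩ := hx
    exact ⟨-n, by push_cast; rw [← hn, map_neg]; ring⟩

theorem RD.isP_of_sub (h : RD Δ α θ B) {x y : E} (hx : IsP B Δ x)
    (hq : y - x ∈ AddSubgroup.closure (Set.range α)) : IsP B Δ y := by
  intro β hβ
  obtain ⟨n, hn⟩ := hx β hβ
  obtain ⟨m, hm⟩ := h.isP_root hq β hβ
  exact ⟨n + m, by push_cast; rw [← hn, ← hm, map_sub]; ring⟩

theorem int_smul_mem {x : E} {S : AddSubgroup E} (hx : x ∈ S) (n : ℤ) : (n : ℝ) • x ∈ S := by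
  rw [Int.cast_smul_eq_zsmul]; exact S.zsmul_mem hx n

theorem RD.sR_Q (h : RD Δ α θ B) {x : E} (hx : IsP B Δ x) {β : E} (hβ : β ∈ Δ) :
    sR B β x - x ∈ AddSubgroup.closure (Set.range α) := by
  obtain ⟨m, hm⟩ := hx β hβ
  rw [sR, hm, sub_sub_cancel_left]
  exact neg_mem (int_smul_mem (mem_Q_of_mem (h.hpos β hβ)) m)

theorem RD.gen_Q (h : RD Δ α θ B) {x : E} (hx : IsP B Δ x) (k : ℕ) (o : Option ι) :
    gen B α θ k o x - x ∈ AddSubgroup.closure (Set.range α) := by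
  cases o with
  | none =>
    have h1 := h.sR_Q hx h.hθ
    have h2 := int_smul_mem (mem_Q_of_mem (h.hpos θ h.hθ)) (k : ℤ)
    have := add_mem h1 h2
    convert this using 1
    simp only [gen]; push_cast; abel
  | some i => exact h.sR_Q hx (h.hα i)

theorem RD.fw_Q (h : RD Δ α θ B) {x : E} (hx : IsP B Δ x) (L : List ι) :
    fw B α L x - x ∈ AddSubgroup.closure (Set.range α) := by
  induction L with
  | nil => simp [fw, word]
  | cons i L ih =>
    have := add_mem (h.sR_Q (h.isP_of_sub hx ih) (h.hα i)) ih
    rw [fw_cons]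
    convert this using 1
    abel

/-! ### the order -/

/-- one step up by an affine reflection, inside a coset of the root lattice -/
def Step (Δ : Finset E) (α : ι → E) (B : E →ₗ[ℝ] E →ₗ[ℝ] ℝ) (k : ℝ) (lam x y : E) : Prop :=
  x - lam ∈ AddSubgroup.closure (Set.range α) ∧ y - lam ∈ AddSubgroup.closure (Set.range α) ∧
  ∃ φ, Pos Δ φ ∧ 0 ≤ ev B k φ x ∧ y = tR B k φ x

theorem RD.step_lift (h : RD Δ α θ B) (k : ℕ) {lam x y : E} (hP : IsP B Δ lam)
    (hs : Step Δ α B k lam x y) (o : Option ι) :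
    gen B α θ k o x = y ∨ Step Δ α B k lam (gen B α θ k o x) (gen B α θ k o y) := by
  obtain ⟨hx, hy, φ, hφ, he, rfl⟩ := hs
  rcases h.pos_act k o hφ with h1 | h1
  · right
    have g : ∀ z, z - lam ∈ AddSubgroup.closure (Set.range α) →
        gen B α θ k o z - lam ∈ AddSubgroup.closure (Set.range α) := by
      intro z hz
      have := add_mem (h.gen_Q (h.isP_of_sub hP hz) k o) hz
      convert this using 1
      abel
    refine ⟨g _ hx, g _ hy, act B α θ o φ, h1, ?_, (h.tR_act _ _ _ _).symm⟩
    rwa [h.ev_act, h.gen_gen]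
  · left; rw [h1]

theorem RD.rel_lift (h : RD Δ α θ B) (k : ℕ) {lam x y : E} (hP : IsP B Δ lam)
    (hs : Relation.ReflTransGen (Step Δ α B k lam) x y) (o : Option ι) :
    Relation.ReflTransGen (Step Δ α B k lam) (gen B α θ k o x) y ∨
    Relation.ReflTransGen (Step Δ α B k lam) (gen B α θ k o x) (gen B α θ k o y) := by
  induction hs using Relation.ReflTransGen.head_induction_on with
  | refl => exact Or.inr .refl
  | head hxz hzy ih =>
    rcases h.step_lift k hP hxz o with h1 | h1
    · left; rw [h1]; exact hzy
    · exact ih.imp (fun h2 => .head h1 h2) (fun h2 => .head h1 h2)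

theorem RD.word_Q (h : RD Δ α θ B) {x : E} (hx : IsP B Δ x) (k : ℕ) (L : List (Option ι)) :
    word B α θ k L x - x ∈ AddSubgroup.closure (Set.range α) := by
  induction L with
  | nil => simp [word]
  | cons i L ih =>
    have := add_mem (h.gen_Q (h.isP_of_sub hx ih) k i) ih
    simp only [word, Function.comp]
    convert this using 1
    abel

theorem RD.bruhat_rel (h : RD Δ α θ B) {k : ℕ} (hk : 0 < k) {lam : E} (hP : IsP B Δ lam)
    (hd : ∀ β ∈ Δ, 0 ≤ B β lam) (hl : B θ lam ≤ k) (L : List (Option ι))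
    (hred : ∀ M, (∀ x, word B α θ k M x = word B α θ k L x) → L.length ≤ M.length)
    (M : List (Option ι)) (hM : M.Sublist L) :
    Relation.ReflTransGen (Step Δ α B k lam) (word B α θ k M lam) (word B α θ k L lam) := by
  induction L generalizing M with
  | nil => rw [List.sublist_nil.1 hM]
  | cons o L ih =>
    have hred' : ∀ M, (∀ x, word B α θ k M x = word B α θ k L x) → L.length ≤ M.length := by
      intro M hM
      have := hred (o :: M) (fun x => by simp [word, hM])
      simpa using this
    have hside := h.side (Nat.cast_pos.2 hk) hd hl hred
    have hst : Step Δ α B k lam (word B α θ k L lam) (word B α θ k (o :: L) lam) :=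
      ⟨h.word_Q hP k _, h.word_Q hP k _, simp0 α θ o, h.pos_simp o, hside, (h.tR_simp _ _ _).symm⟩
    cases hM with
    | cons _ hM => exact (ih hred' _ hM).tail hst
    | cons_cons _ hM =>
      rcases h.rel_lift k hP (ih hred' _ hM) o with h1 | h1
      · exact h1.tail hst
      · exact h1

section dmin
variable {dmin : E → E}

theorem RD.dmin_le (h : RD Δ α θ B) (ho : ∀ x, ∃ L : List ι, dmin x = fw B α L x)
    (ha : ∀ x i, B (α i) (dmin x) ≤ 0) {y : E} (hy : IsP B Δ y) (L : List ι) :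
    fw B α L y - dmin y ∈ AddSubmonoid.closure (Set.range α) := by
  obtain ⟨M, hM⟩ := ho y
  apply mem_of_cone h.indep
  · have := h.fin_ge (ha y) _ (L ++ M.reverse) rfl
    rwa [fw_append, show fw B α M.reverse (dmin y) = y by rw [hM, h.fw_reverse]] at this
  · have := sub_mem (h.fw_Q hy L) (h.fw_Q hy M)
    rw [← hM] at this
    convert this using 1
    abel

theorem RD.step_dmin (h : RD Δ α θ B) (ho : ∀ x, ∃ L : List ι, dmin x = fw B α L x)
    (ha : ∀ x i, B (α i) (dmin x) ≤ 0) {k : ℕ} {lam x y : E} (hP : IsP B Δ lam)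
    (hs : Step Δ α B k lam x y) :
    dmin x - dmin y ∈ AddSubmonoid.closure (Set.range α) := by
  obtain ⟨hx, hy, ⟨b, m⟩, ⟨hb, -, hm⟩, he, e⟩ := hs
  have hPx := h.isP_of_sub hP hx
  have hPy := h.isP_of_sub hP hy
  obtain ⟨L, hL⟩ := ho x
  have hxy : x - y ∈ AddSubgroup.closure (Set.range α) := by
    have := sub_mem hx hy
    simpa using this
  have hbb : 0 < B b b := by
    rcases hb with hb | hb
    · exact h.pos b hb
    · have := h.pos _ hb; simpa using this
  simp only at hm hb
  -- images under `L` of lattice elements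
  have hLQ : ∀ z, z ∈ AddSubgroup.closure (Set.range α) →
      fw B α L z ∈ AddSubgroup.closure (Set.range α) := by
    intro z hz
    have := add_mem (h.fw_Q (h.isP_root hz) L) hz
    simpa using this
  rcases h.fw_root L hb with hr | hr
  · have h1 : fw B α L x - fw B α L y ∈ AddSubmonoid.closure (Set.range α) := by
      apply mem_of_cone h.indep
      · rw [← fw_sub, e, tR, sub_sub_cancel, fw_smul]
        exact (h.cone hr).smul (div_nonneg (by linarith) hbb.le)
      · rw [← fw_sub]; exact hLQ _ hxy
    have := add_mem h1 (h.dmin_le ho ha hPy L)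
    rw [hL]
    convert this using 1
    abel
  · have hsQ : sR B b y - y ∈ AddSubgroup.closure (Set.range α) := by
      rcases hb with hb | hb
      · exact h.sR_Q hPy hb
      · have := h.sR_Q hPy hb
        rwa [sR_negroot] at this
    obtain ⟨M, hMs⟩ : ∃ M : List ι, ∀ z, sR B b z = fw B α M z := by
      rcases hb with hb | hb
      · exact h.refl_word' hb
      · obtain ⟨M, hM⟩ := h.refl_word' hb
        exact ⟨M, fun z => by rw [← hM, sR_negroot]⟩
    have ex : x - sR B b y = (2 * (m * k) / B b b) • (-b) := by
      have hne := hbb.ne'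
      rw [e, sR, tR, ev]
      simp only [map_sub, map_smul, smul_eq_mul]
      match_scalars
      · ring
      · field_simp; ring
    have hm0 : 0 ≤ m := by rcases hm with hm | ⟨hm, -⟩ <;> linarith
    have h1 : fw B α L x - fw B α L (sR B b y) ∈ AddSubmonoid.closure (Set.range α) := by
      apply mem_of_cone h.indep
      · rw [← fw_sub, ex, fw_smul, fw_neg]
        exact (h.cone hr).smul (by positivity)
      · rw [← fw_sub]
        apply hLQ
        have := sub_mem hxy hsQ
        simpa using this
    have h2 := h.dmin_le ho ha hPy (L ++ M)
    rw [fw_append, ← hMs] at h2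
    have := add_mem h1 h2
    rw [hL]
    convert this using 1
    abel

theorem RD.rel_dmin (h : RD Δ α θ B) (ho : ∀ x, ∃ L : List ι, dmin x = fw B α L x)
    (ha : ∀ x i, B (α i) (dmin x) ≤ 0) {k : ℕ} {lam x y : E} (hP : IsP B Δ lam)
    (hs : Relation.ReflTransGen (Step Δ α B k lam) x y) :
    dmin x - dmin y ∈ AddSubmonoid.closure (Set.range α) := by
  induction hs with
  | refl => rw [sub_self]; exact zero_mem _
  | tail _ h2 ih =>
    have := add_mem ih (h.step_dmin ho ha hP h2)
    simpa using this

end dmin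
end RDsec

/-- existence of a normalized invariant form -/
theorem exists_form (Δ : Finset E) (pairing : E → E →ₗ[ℝ] ℝ) (W : Subgroup (E ≃ₗ[ℝ] E))
    (hWfin : Finite W) (hself : ∀ β ∈ Δ, pairing β β = 2) {θ : E} (hθ : θ ∈ Δ) :
    ∃ B : E →ₗ[ℝ] E →ₗ[ℝ] ℝ, (∀ x y, B x y = B y x) ∧ (∀ β ∈ Δ, 0 < B β β) ∧ B θ θ = 2 ∧
      ∀ g ∈ W, ∀ x y, B (g x) (g y) = B x y := by
  classical
  have := Fintype.ofFinite W
  let B0 : E →ₗ[ℝ] E →ₗ[ℝ] ℝ := ∑ g : W, ∑ β ∈ Δ,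
    LinearMap.mk₂ ℝ (fun x y => pairing β (g.1 x) * pairing β (g.1 y))
      (by intros; simp [add_mul]) (by intros; simp [mul_assoc])
      (by intros; simp [mul_add]) (by intros; simp; ring)
  have hB0 : ∀ x y, B0 x y = ∑ g : W, ∑ β ∈ Δ, pairing β (g.1 x) * pairing β (g.1 y) := by
    intro x y
    simp [B0, LinearMap.sum_apply]
  have hp : ∀ β ∈ Δ, 0 < B0 β β := by
    intro β hβ
    rw [hB0]
    have hnn : ∀ g : W, 0 ≤ ∑ γ ∈ Δ, pairing γ (g.1 β) * pairing γ (g.1 β) :=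
      fun g => Finset.sum_nonneg fun γ _ => mul_self_nonneg _
    refine Finset.sum_pos' (fun g _ => hnn g) ⟨1, Finset.mem_univ _, ?_⟩
    refine Finset.sum_pos' (fun γ _ => mul_self_nonneg _) ⟨β, hβ, ?_⟩
    simp [hself β hβ]
  refine ⟨(2 / B0 θ θ) • B0, ?_, ?_, ?_, ?_⟩
  · intro x y
    simp only [LinearMap.smul_apply, hB0, mul_comm]
  · intro β hβ
    have h1 := hp β hβ
    have h2 := hp θ hθ
    simp only [LinearMap.smul_apply, smul_eq_mul]
    positivity
  · have h2 := (hp θ hθ).ne'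
    simp only [LinearMap.smul_apply, smul_eq_mul]
    field_simp
  · intro g hg x y
    simp only [LinearMap.smul_apply]
    congr 1
    rw [hB0, hB0]
    exact Equiv.sum_comp (Equiv.mulRight (⟨g, hg⟩ : W))
      (fun u : W => ∑ β ∈ Δ, pairing β (u.1 x) * pairing β (u.1 y))

end CherAux
end

theorem bruhat_le_implies_cherednik_le_of_level_dominant
    {E : Type} [AddCommGroup E] [Module ℝ E]
    {ι : Type} [Fintype ι] [Nonempty ι]
    (Δ : Finset E) (α : ι → E) (pairing : E → E →ₗ[ℝ] ℝ)
    (θ : E)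
    (W : Subgroup (E ≃ₗ[ℝ] E))
    (dmin : E → E)
    -- axioms of the (simple, crystallographic) root datum
    (hα : ∀ i, α i ∈ Δ)
    (hαindep : LinearIndependent ℝ α)
    (hpos : ∀ β ∈ Δ, β ∈ AddSubmonoid.closure (Set.range α))
    (hpair_self : ∀ β ∈ Δ, pairing β β = 2)
    (hcrys : ∀ β ∈ Δ, ∀ γ ∈ Δ, ∃ m : ℤ, pairing β γ = (m : ℝ))
    (hW : W = Subgroup.closure
      {g : E ≃ₗ[ℝ] E | ∃ β ∈ Δ, ∀ x : E, g x = x - pairing β x • β})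
    (hWfin : Finite W)
    (hWroots : ∀ w ∈ W, ∀ β ∈ Δ, (w β ∈ Δ ∨ -(w β) ∈ Δ))
    -- the weight lattice `P` and the positive monoid `Q₊`
    (P : Set E) (hP : P = {x : E | ∀ β ∈ Δ, ∃ m : ℤ, pairing β x = (m : ℝ)})
    (Qplus : AddSubmonoid E) (hQplus : Qplus = AddSubmonoid.closure (Set.range α))
    -- `θ` is the highest root
    (hθ : θ ∈ Δ) (hθ_high : ∀ β ∈ Δ, θ - β ∈ Qplus)
    -- `dmin λ = λ₋`, the antidominant representative of the orbit `W λ`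
    (hdmin_orbit : ∀ x : E, ∃ w ∈ W, dmin x = w x)
    (hdmin_antidom : ∀ x : E, ∀ β ∈ Δ, pairing β (dmin x) ≤ 0)
    -- the Cherednik order
    (cherLE : E → E → Prop)
    (hcher : ∀ x y : E, cherLE x y ↔
      (dmin x - dmin y ∈ Qplus ∨ (dmin x = dmin y ∧ x - y ∈ Qplus)))
    -- the level and the weight
    (k : ℕ) (hk : 0 < k)
    (lam : E) (hlamP : lam ∈ P) (hlam_dom : ∀ β ∈ Δ, 0 ≤ pairing β lam)
    (hlam_level : pairing θ lam ≤ (k : ℝ))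
    -- elements of the affine Weyl group comparable in Bruhat order
    (w v : E → E) (hwv : AffBruhatLE pairing α θ k w v) :
    cherLE (w lam) (v lam) := by
  classical
  subst hP hQplus
  have hsW : ∀ β ∈ Δ, ∃ g ∈ W, ∀ x : E, g x = x - pairing β x • β := by
    intro β hβ
    refine ⟨Module.reflection (hpair_self β hβ), ?_, fun x => Module.reflection_apply x (hpair_self β hβ)⟩
    rw [hW]
    exact Subgroup.subset_closure ⟨β, hβ, fun x => Module.reflection_apply x (hpair_self β hβ)⟩
  obtain ⟨B, hsymm, hBpos, hBθ, hinv⟩ :=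
    CherAux.exists_form Δ pairing W hWfin hpair_self hθ
  have hpB : ∀ β ∈ Δ, ∀ x, pairing β x = 2 * B β x / B β β := by
    intro β hβ x
    obtain ⟨g, hg, hgx⟩ := hsW β hβ
    have h1 := hinv g hg β x
    rw [hgx, hgx, hpair_self β hβ] at h1
    have h2 := (hBpos β hβ).ne'
    simp only [map_sub, map_smul, LinearMap.sub_apply, LinearMap.smul_apply, smul_eq_mul] at h1
    field_simp
    linarith
  have hsR : ∀ β ∈ Δ, ∀ x, CherAux.sR B β x = x - pairing β x • β := by
    intro β hβ x
    rw [CherAux.sR, hpB β hβ]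
  have h : CherAux.RD Δ α θ B :=
    { symm := hsymm
      pos := hBpos
      hα := hα
      indep := hαindep
      hpos := hpos
      refl := by
        intro β hβ γ hγ
        obtain ⟨g, hg, hgx⟩ := hsW β hβ
        rw [hsR β hβ, ← hgx]
        exact hWroots g hg γ hγ
      crys := by
        intro β hβ γ hγ
        rw [← hpB β hβ]
        exact hcrys β hβ γ hγ
      hθ := hθ
      norm := hBθ
      high := hθ_high }
  have hgen : ∀ o x, affGen pairing α θ k o x = CherAux.gen B α θ k o x := by
    intro o x
    cases o with
    | none => simp only [affGen, sRefl, CherAux.gen, hsR θ hθ]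
    | some i => simp only [affGen, sRefl, CherAux.gen, hsR _ (hα i)]
  have hword : ∀ L x, wordProd pairing α θ k L x = CherAux.word B α θ k L x := by
    intro L
    induction L with
    | nil => intro x; rfl
    | cons o L ih =>
      intro x
      change affGen pairing α θ k o (wordProd pairing α θ k L x) = _
      rw [hgen, ih]; rfl
  have hWword : ∀ g ∈ W, ∃ L : List ι, ∀ x, g x = CherAux.fw B α L x := by
    intro g hg
    rw [hW] at hg
    induction hg using Subgroup.closure_induction with
    | mem g hg =>
      obtain ⟨β, hβ, hgx⟩ := hg
      obtain ⟨L, hL⟩ := h.refl_word' hβ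
      exact ⟨L, fun x => by rw [← hL, hgx, hsR β hβ]⟩
    | one => exact ⟨[], fun x => rfl⟩
    | mul a b _ _ ha hb =>
      obtain ⟨L, hL⟩ := ha
      obtain ⟨M, hM⟩ := hb
      exact ⟨L ++ M, fun x => by rw [CherAux.fw_append, ← hM, ← hL]; rfl⟩
    | inv a _ ha =>
      obtain ⟨L, hL⟩ := ha
      refine ⟨L.reverse, fun x => ?_⟩
      have e : x = CherAux.fw B α L (a⁻¹ x) := by
        rw [← hL]; exact (LinearEquiv.apply_symm_apply a x).symm
      conv_rhs => rw [e]
      rw [h.fw_reverse]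
  have ho : ∀ x, ∃ L : List ι, dmin x = CherAux.fw B α L x := by
    intro x
    obtain ⟨g, hg, e⟩ := hdmin_orbit x
    obtain ⟨L, hL⟩ := hWword g hg
    exact ⟨L, by rw [e, hL]⟩
  have hsign : ∀ β ∈ Δ, ∀ x, B β x = pairing β x * (B β β / 2) := by
    intro β hβ x
    have h2 := (hBpos β hβ).ne'
    rw [hpB β hβ]; field_simp
  have ha : ∀ x i, B (α i) (dmin x) ≤ 0 := by
    intro x i
    rw [hsign _ (hα i)]
    have h1 := hdmin_antidom x _ (hα i)
    have h2 := hBpos _ (hα i)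
    exact mul_nonpos_of_nonpos_of_nonneg h1 (by linarith)
  have hlP : CherAux.IsP B Δ lam := by
    intro β hβ
    rw [← hpB β hβ]
    exact hlamP β hβ
  obtain ⟨lv, rfl, hred, lw, hsub, rfl, -⟩ := hwv
  rw [hcher]
  left
  rw [hword, hword]
  refine h.rel_dmin ho ha hlP (h.bruhat_rel hk hlP ?_ ?_ lv ?_ lw hsub)
  · intro β hβ
    rw [hsign β hβ]
    have h2 := hBpos _ hβ
    exact mul_nonneg (hlam_dom β hβ) (by linarith)
  · rw [hsign θ hθ, hBθ]; linarith
  · intro M hM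
    exact hred M (funext fun x => by rw [hword, hword, hM])
end

section
/- Let V be a finite-dimensional module over sl(2,ℂ) with standard basis (e, h, f), and suppose V = V_1 ⊕ ⋯ ⊕ V_N is a direct sum of irreducible submodules whose highest weights n_1, …, n_N ∈ ℤ_{≥0} are pairwise distinct. Let v ∈ V be an h-eigenvector of eigenvalue r ∈ ℤ, and assume that V is generated as an sl(2,ℂ)-module by the vectors {e^m v : m ∈ ℤ_{≥0}}. Then n_j ≥ |r| for every j = 1, …, N, and for every m ∈ ℤ_{≥0} and every j, the component of e^m v in the summand V_j (with respect to the given direct sum decomposition) is nonzero if and only if r + 2m ≤ n_j. -/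
namespace Sl2Aux

variable {V : Type} [AddCommGroup V] [Module ℂ V]

lemma H_pow {E H F : Module.End ℂ V} (hHF : H * F - F * H = -((2 : ℂ) • F))
    {u : V} {n : ℕ} (hH : H u = (n : ℂ) • u) (i : ℕ) :
    H ((F ^ i) u) = ((n : ℂ) - 2 * i) • (F ^ i) u := by
  induction i with
  | zero => simpa using hH
  | succ i ih =>
    have h := LinearMap.congr_fun hHF ((F ^ i) u)
    simp only [LinearMap.sub_apply, Module.End.mul_apply, LinearMap.neg_apply,
      LinearMap.smul_apply, ih, map_smul] at h
    rw [pow_succ', Module.End.mul_apply, sub_eq_iff_eq_add.mp h]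
    push_cast
    module

lemma E_pow {E H F : Module.End ℂ V} (hHF : H * F - F * H = -((2 : ℂ) • F))
    (hEF : E * F - F * E = H)
    {u : V} {n : ℕ} (hE : E u = 0) (hH : H u = (n : ℂ) • u) (i : ℕ) :
    E ((F ^ (i + 1)) u) = (((i : ℂ) + 1) * ((n : ℂ) - i)) • (F ^ i) u := by
  induction i with
  | zero =>
    have h := LinearMap.congr_fun hEF u
    simp only [LinearMap.sub_apply, Module.End.mul_apply, hE, hH, map_zero, sub_zero] at h
    simpa using h
  | succ i ih =>
    have h := LinearMap.congr_fun hEF ((F ^ (i + 1)) u)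
    simp only [LinearMap.sub_apply, Module.End.mul_apply, ih, map_smul,
      H_pow (E := E) hHF hH] at h
    rw [pow_succ' F (i + 1), Module.End.mul_apply, sub_eq_iff_eq_add.mp h,
      ← Module.End.mul_apply F, ← pow_succ']
    push_cast
    module

lemma F_pow_zero [FiniteDimensional ℂ V] {E H F : Module.End ℂ V}
    (hHE : H * E - E * H = (2 : ℂ) • E)
    (hHF : H * F - F * H = -((2 : ℂ) • F))
    (hEF : E * F - F * E = H)
    {u : V} {n : ℕ} (hu : u ≠ 0) (hE : E u = 0) (hH : H u = (n : ℂ) • u) :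
    (F ^ (n + 1)) u = 0 := by
  by_cases h0 : H = 0
  · have : F = 0 := by
      rw [h0] at hHF
      simpa using hHF
    simp [this]
  · letI : LieRing (Module.End ℂ V) := LieRing.ofAssociativeRing
    have t : IsSl2Triple H E F :=
      { h_ne_zero := h0
        lie_e_f := by rw [Ring.lie_def, hEF]
        lie_h_e_nsmul := by rw [Ring.lie_def, hHE, two_smul, two_smul]
        lie_h_f_nsmul := by rw [Ring.lie_def, hHF, two_smul, two_smul] }
    have P : t.HasPrimitiveVectorWith u (n : ℂ) := ⟨hu, hH, hE⟩
    exact P.pow_toEnd_f_eq_zero_of_eq_nat rfl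

lemma E_pow_F_pow {E H F : Module.End ℂ V}
    (hHF : H * F - F * H = -((2 : ℂ) • F))
    (hEF : E * F - F * E = H)
    {u : V} {n : ℕ} (hu : u ≠ 0) (hE : E u = 0) (hH : H u = (n : ℂ) • u)
    (i : ℕ) (hi : i ≤ n) : ∀ m : ℕ, (E ^ m) ((F ^ i) u) ≠ 0 ↔ m ≤ i := by
  induction i with
  | zero =>
    intro m
    cases m with
    | zero => simpa using hu
    | succ m => simp [pow_succ, hE]
  | succ i ih =>
    have ih := ih (by omega)
    have hc : (((i : ℂ) + 1) * ((n : ℂ) - i)) ≠ 0 := by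
      refine mul_ne_zero (Nat.cast_add_one_ne_zero i) (sub_ne_zero.mpr ?_)
      have : n ≠ i := by omega
      exact_mod_cast this
    have hE1 := E_pow hHF hEF hE hH i
    intro m
    cases m with
    | zero =>
      simp only [zero_le, iff_true]
      intro h
      rw [pow_zero, Module.End.one_apply] at h
      rw [h, map_zero] at hE1
      have := (ih 0).mpr (Nat.zero_le _)
      rw [pow_zero, Module.End.one_apply] at this
      exact smul_ne_zero hc this hE1.symm
    | succ m =>
      rw [pow_succ E, Module.End.mul_apply, hE1, map_smul, Nat.add_le_add_iff_right, ← ih m,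
        smul_ne_zero_iff]
      simp [hc]

/-- A weight vector in an irreducible module is a multiple of some `F ^ i u`. -/
lemma weight_vec [FiniteDimensional ℂ V] {E H F : Module.End ℂ V}
    (hHE : H * E - E * H = (2 : ℂ) • E)
    (hHF : H * F - F * H = -((2 : ℂ) • F))
    (hEF : E * F - F * E = H) (W : Submodule ℂ V)
    (hWF : ∀ x ∈ W, F x ∈ W)
    (hirr : ∀ p : Submodule ℂ V, p ≤ W →
      (∀ x ∈ p, E x ∈ p) → (∀ x ∈ p, H x ∈ p) → (∀ x ∈ p, F x ∈ p) →
      p = ⊥ ∨ p = W)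
    {u : V} {n : ℕ} (huW : u ∈ W) (hu : u ≠ 0) (hE : E u = 0) (hH : H u = (n : ℂ) • u)
    {w : V} (hwW : w ∈ W) (hw : w ≠ 0) {r : ℤ} (hwH : H w = (r : ℂ) • w) :
    ∃ i ≤ n, r = (n : ℤ) - 2 * i ∧ ∃ a : ℂ, a ≠ 0 ∧ w = a • (F ^ i) u := by
  let b : Fin (n + 1) → V := fun i => (F ^ (i : ℕ)) u
  have hbm : ∀ i, i ≤ n → (F ^ i) u ∈ Submodule.span ℂ (Set.range b) := fun i hi =>
    Submodule.subset_span ⟨⟨i, by omega⟩, rfl⟩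
  have key : ∀ A : Module.End ℂ V,
      (∀ i, i ≤ n → A ((F ^ i) u) ∈ Submodule.span ℂ (Set.range b)) →
      ∀ x ∈ Submodule.span ℂ (Set.range b), A x ∈ Submodule.span ℂ (Set.range b) := by
    intro A hA
    change Submodule.span ℂ (Set.range b) ≤ (Submodule.span ℂ (Set.range b)).comap A
    rw [Submodule.span_le]
    rintro _ ⟨i, rfl⟩
    exact hA i (by omega)
  have hspan : Submodule.span ℂ (Set.range b) = W := by
    refine (hirr _ ?_ (key E ?_) (key H ?_) (key F ?_)).resolve_left ?_
    · rw [Submodule.span_le]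
      rintro _ ⟨i, rfl⟩
      have : ∀ k : ℕ, (F ^ k) u ∈ W := by
        intro k
        induction k with
        | zero => simpa using huW
        | succ k ih => rw [pow_succ']; exact hWF _ ih
      exact this i
    · intro i hi
      cases i with
      | zero => simp [hE]
      | succ i =>
        rw [E_pow hHF hEF hE hH]
        exact Submodule.smul_mem _ _ (hbm i (by omega))
    · intro i hi
      rw [H_pow (E := E) hHF hH]
      exact Submodule.smul_mem _ _ (hbm i hi)
    · intro i hi
      rw [← Module.End.mul_apply, ← pow_succ']
      rcases Nat.lt_or_ge i n with h | h
      · exact hbm _ h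
      · obtain rfl : i = n := le_antisymm hi h
        rw [F_pow_zero hHE hHF hEF hu hE hH]
        exact Submodule.zero_mem _
    · intro h
      have := hbm 0 (Nat.zero_le _)
      rw [h, Submodule.mem_bot] at this
      exact hu (by simpa using this)
  have hli : LinearIndependent ℂ b := by
    refine Module.End.eigenvectors_linearIndependent' H
      (fun i : Fin (n + 1) => (n : ℂ) - 2 * (i : ℕ)) ?_ b ?_
    · intro i j hij
      have h2 : (i : ℕ) = (j : ℕ) := by
        have : ((i : ℕ) : ℂ) = (j : ℕ) := by
          simpa using hij
        exact_mod_cast this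
      exact Fin.ext h2
    · intro i
      rw [Module.End.hasEigenvector_iff, Module.End.mem_eigenspace_iff]
      refine ⟨H_pow (E := E) hHF hH i, ?_⟩
      have := (E_pow_F_pow hHF hEF hu hE hH i (by omega) 0).mpr (Nat.zero_le _)
      simpa using this
  rw [← hspan, Submodule.mem_span_range_iff_exists_fun] at hwW
  obtain ⟨a, rfl⟩ := hwW
  have hcoef : ∀ i : Fin (n + 1), a i ≠ 0 → r = (n : ℤ) - 2 * (i : ℕ) := by
    have h1 : ∑ i : Fin (n + 1), (((n : ℂ) - 2 * (i : ℕ) - r) * a i) • b i = 0 := by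
      rw [map_sum, Finset.smul_sum, ← sub_eq_zero, ← Finset.sum_sub_distrib] at hwH
      rw [← hwH]
      refine Finset.sum_congr rfl fun i _ => ?_
      rw [map_smul, show H (b i) = _ from H_pow (E := E) hHF hH i]
      change _ = a i • _ • b i - _
      module
    intro i hi
    have := Fintype.linearIndependent_iff.mp hli _ h1 i
    have h3 := (mul_eq_zero.mp this).resolve_right hi
    have h4 : (r : ℂ) = (n : ℂ) - 2 * (i : ℕ) := (sub_eq_zero.mp h3).symm
    exact_mod_cast h4
  obtain ⟨i, hi⟩ : ∃ i, a i ≠ 0 := by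
    by_contra! h
    exact hw (by simp [h])
  refine ⟨i, by omega, hcoef i hi, a i, hi, ?_⟩
  refine Finset.sum_eq_single i (fun k _ hk => ?_) (by simp)
  by_cases hak : a k = 0
  · simp [hak]
  · exfalso
    have := hcoef i hi
    have := hcoef k hak
    exact hk (Fin.ext (by omega))

lemma comp_unique {N : ℕ} {Vs : Fin N → Submodule ℂ V}
    (hdirect : DirectSum.IsInternal Vs) {x y : Fin N → V}
    (hx : ∀ j, x j ∈ Vs j) (hy : ∀ j, y j ∈ Vs j) (h : ∑ j, x j = ∑ j, y j) (j : Fin N) :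
    x j = y j := by
  have hz := hdirect.submodule_iSupIndep
  rw [iSupIndep_iff_forall_dfinsupp] at hz
  have := hdirect.injective
  let X : DirectSum (Fin N) fun j => Vs j := DFinsupp.equivFunOnFintype.symm fun j => ⟨x j, hx j⟩
  let Y : DirectSum (Fin N) fun j => Vs j := DFinsupp.equivFunOnFintype.symm fun j => ⟨y j, hy j⟩
  have e : ∀ Z : DirectSum (Fin N) fun j => Vs j,
      DirectSum.coeAddMonoidHom Vs Z = ∑ j, (Z j : V) := by
    intro Z
    classical
    rw [DirectSum.coeAddMonoidHom_eq_dfinsuppSum]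
    exact DFinsupp.sum_eq_sum_fintype _ (fun _ => rfl)
  have hXY : X = Y := this (by rw [e, e]; exact h)
  exact congrArg (fun Z : DirectSum (Fin N) fun j => Vs j => (Z j : V)) hXY

lemma pow_mem {E : Module.End ℂ V} {W : Submodule ℂ V} (h : ∀ x ∈ W, E x ∈ W) {x : V}
    (hx : x ∈ W) (m : ℕ) : (E ^ m) x ∈ W := by
  induction m with
  | zero => simpa using hx
  | succ m ih => rw [pow_succ']; exact h _ ih

end Sl2Aux

theorem sl2_component_of_power_nonzero_iff
    {V : Type} [AddCommGroup V] [Module ℂ V] [FiniteDimensional ℂ V]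
    (E H F : Module.End ℂ V)
    (hHE : H * E - E * H = (2 : ℂ) • E)
    (hHF : H * F - F * H = -((2 : ℂ) • F))
    (hEF : E * F - F * E = H)
    (N : ℕ) (Vs : Fin N → Submodule ℂ V) (n : Fin N → ℕ)
    -- the highest weights are pairwise distinct
    (hn : Function.Injective n)
    -- each `Vs j` is an `sl(2,ℂ)`-submodule
    (hinv : ∀ j, (∀ x ∈ Vs j, E x ∈ Vs j) ∧ (∀ x ∈ Vs j, H x ∈ Vs j) ∧
      (∀ x ∈ Vs j, F x ∈ Vs j))
    -- each `Vs j` is irreducible ...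
    (hne : ∀ j, Vs j ≠ ⊥)
    (hirr : ∀ j, ∀ p : Submodule ℂ V, p ≤ Vs j →
      (∀ x ∈ p, E x ∈ p) → (∀ x ∈ p, H x ∈ p) → (∀ x ∈ p, F x ∈ p) →
      p = ⊥ ∨ p = Vs j)
    -- ... of highest weight `n j`
    (hhw : ∀ j, ∃ u ∈ Vs j, u ≠ 0 ∧ E u = 0 ∧ H u = ((n j : ℂ)) • u)
    -- `V = Vs 0 ⊕ ⋯ ⊕ Vs (N-1)`
    (hdirect : DirectSum.IsInternal Vs)
    -- `v` is an `H`-eigenvector of integer eigenvalue `r`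
    (v : V) (r : ℤ) (hv0 : v ≠ 0) (hvH : H v = (r : ℂ) • v)
    -- `V` is generated as an `sl(2,ℂ)`-module by the vectors `E^m v`
    (hgen : ∀ p : Submodule ℂ V,
      (∀ x ∈ p, E x ∈ p) → (∀ x ∈ p, H x ∈ p) → (∀ x ∈ p, F x ∈ p) →
      (∀ m : ℕ, (E ^ m) v ∈ p) → p = ⊤) :
    (∀ j, |r| ≤ (n j : ℤ)) ∧
    ∀ (m : ℕ) (x : Fin N → V), (∀ j, x j ∈ Vs j) → (∑ j, x j) = (E ^ m) v →
      ∀ j, (x j ≠ 0 ↔ r + 2 * (m : ℤ) ≤ (n j : ℤ)) := by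
  classical
  -- decompose `v`
  obtain ⟨x0, hx0, hsum⟩ : ∃ x0 : Fin N → V, (∀ j, x0 j ∈ Vs j) ∧ ∑ j, x0 j = v := by
    have hv : v ∈ ⨆ j, Vs j := by rw [hdirect.submodule_iSup_eq_top]; trivial
    rw [Submodule.mem_iSup_iff_exists_finsupp] at hv
    obtain ⟨f, hf, hfs⟩ := hv
    exact ⟨f, hf, by rw [← hfs, Finsupp.sum_fintype _ _ (fun _ => rfl)]⟩
  have hxH : ∀ j, H (x0 j) = (r : ℂ) • x0 j := by
    refine Sl2Aux.comp_unique hdirect (x := fun j => H (x0 j)) (y := fun j => (r : ℂ) • x0 j)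
      (fun j => (hinv j).2.1 _ (hx0 j)) (fun j => Submodule.smul_mem _ _ (hx0 j)) ?_
    rw [← map_sum, ← Finset.smul_sum, hsum, hvH]
  have hxne : ∀ j, x0 j ≠ 0 := by
    intro j hj
    have hA : ∀ A : Module.End ℂ V, (∀ i, ∀ x ∈ Vs i, A x ∈ Vs i) →
        ∀ x ∈ ⨆ i ≠ j, Vs i, A x ∈ ⨆ i ≠ j, Vs i := by
      intro A hA
      change (⨆ i ≠ j, Vs i) ≤ (⨆ i ≠ j, Vs i).comap A
      refine iSup₂_le fun i hi x hx => ?_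
      exact (le_iSup₂ (f := fun i (_ : i ≠ j) => Vs i) i hi) (hA i x hx)
    have hAE := hA E (fun i => (hinv i).1)
    have htop := hgen (⨆ i ≠ j, Vs i) hAE (hA H (fun i => (hinv i).2.1))
      (hA F (fun i => (hinv i).2.2)) (fun m => by
        refine Sl2Aux.pow_mem hAE ?_ m
        rw [← hsum]
        refine Submodule.sum_mem _ fun i _ => ?_
        by_cases hi : i = j
        · rw [hi, hj]; exact Submodule.zero_mem _
        · exact (le_iSup₂ (f := fun i (_ : i ≠ j) => Vs i) i hi) (hx0 i))
    have hd := hdirect.submodule_iSupIndep j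
    rw [htop, disjoint_top] at hd
    exact hne j hd
  have hw : ∀ j, ∃ i ≤ n j, r = (n j : ℤ) - 2 * i ∧
      ∀ m : ℕ, (E ^ m) (x0 j) ≠ 0 ↔ m ≤ i := by
    intro j
    obtain ⟨u, huW, hu, hEu, hHu⟩ := hhw j
    obtain ⟨i, hi, hr, a, ha, hxa⟩ := Sl2Aux.weight_vec hHE hHF hEF (Vs j) (hinv j).2.2 (hirr j)
      huW hu hEu hHu (hx0 j) (hxne j) (hxH j)
    refine ⟨i, hi, hr, fun m => ?_⟩
    rw [hxa, map_smul, smul_ne_zero_iff, Sl2Aux.E_pow_F_pow hHF hEF hu hEu hHu i hi m]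
    simp [ha]
  refine ⟨fun j => ?_, fun m x hx hxs j => ?_⟩
  · obtain ⟨i, hi, hr, -⟩ := hw j
    rw [abs_le]
    omega
  · have hxj : x j = (E ^ m) (x0 j) := by
      refine Sl2Aux.comp_unique hdirect (x := x) (y := fun j => (E ^ m) (x0 j)) hx
        (fun j => Sl2Aux.pow_mem (hinv j).1 (hx0 j) m) ?_ j
      rw [hxs, ← map_sum, hsum]
    obtain ⟨i, hi, hr, h⟩ := hw j
    rw [hxj, h m]
    omega
end
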